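/- arXiv:1609.07628 — 3 statements merged into one kernel-verified Lean document; each statement's English description precedes it below -/
import Mathlib

section
/- (Lemma 5.2) For every v ∈ V and every y ∈ (0,ε), ∫₀¹ |v(x,y) − v̄(x)| dx ≤ ε·𝓔(v)/(1−ν), where v̄(x) = (1/ε)∫₀^ε v(x,ŷ) dŷ is the y-average of v. -/
open MeasureTheory Set

noncomputable section

/-- The `x`-partial derivative of a function on `ℝ × ℝ`. -/
def pdx (v : ℝ × ℝ → ℝ) (p : ℝ × ℝ) : ℝ := fderiv ℝ v p (1, 0)

/-- The `y`-partial derivative of a function on `ℝ × ℝ`. -/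
def pdy (v : ℝ × ℝ → ℝ) (p : ℝ × ℝ) : ℝ := fderiv ℝ v p (0, 1)

/-- The squared norm of the (a.e.-defined) gradient `|∇v|²`. -/
def gradSq (v : ℝ × ℝ → ℝ) (p : ℝ × ℝ) : ℝ := (pdx v p) ^ 2 + (pdy v p) ^ 2

/-- The open domain `D = {(x,y) : φ(y) < x < 1, 0 < y < ε}`. -/
def Dom (ε : ℝ) (φ : ℝ → ℝ) : Set (ℝ × ℝ) :=
  {p | φ p.2 < p.1 ∧ p.1 < 1 ∧ 0 < p.2 ∧ p.2 < ε}

/-- The closed strip `D̄ = {(x,y) : φ(y) ≤ x ≤ 1}`. -/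
def DomBar (φ : ℝ → ℝ) : Set (ℝ × ℝ) := {p | φ p.2 ≤ p.1 ∧ p.1 ≤ 1}

/-- The admissible class `V`: Lipschitz functions on `D̄`, `ε`-periodic in `y`,
vanishing on `x = 1`. -/
def memV (ε : ℝ) (φ : ℝ → ℝ) (v : ℝ × ℝ → ℝ) : Prop :=
  (∃ K : NNReal, LipschitzOnWith K v (DomBar φ)) ∧
  (∀ x y : ℝ, v (x, y + ε) = v (x, y)) ∧
  (∀ y : ℝ, v (1, y) = 0)

/-- The capillary energy functional `𝓔`. -/
def En (ε : ℝ) (φ c : ℝ → ℝ) (v : ℝ × ℝ → ℝ) : ℝ :=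
  (1 / ε) * (∫ p in Dom ε φ, Real.sqrt (1 + gradSq v p)) -
  (1 / ε) * (∫ y in Ioo (0 : ℝ) ε,
    v (φ y, y) * c y * Real.sqrt (1 + (deriv φ y) ^ 2))

/-- First component of the field `∇v / √(1 + |∇v|²)`. -/
def F1 (v : ℝ × ℝ → ℝ) (p : ℝ × ℝ) : ℝ := pdx v p / Real.sqrt (1 + gradSq v p)

/-- Second component of the field `∇v / √(1 + |∇v|²)`. -/
def F2 (v : ℝ × ℝ → ℝ) (p : ℝ × ℝ) : ℝ := pdy v p / Real.sqrt (1 + gradSq v p)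

/-- A capillary solution: a member of `V`, `C²` on `D̄`, solving the minimal surface
equation in `D` and the contact-angle condition on the left boundary. -/
def IsCapillary (ε : ℝ) (φ c : ℝ → ℝ) (u : ℝ × ℝ → ℝ) : Prop :=
  memV ε φ u ∧ ContDiffOn ℝ 2 u (DomBar φ) ∧
  (∀ p ∈ Dom ε φ, pdx (F1 u) p + pdy (F2 u) p = 0) ∧
  (∀ y : ℝ, pdx u (φ y, y) - pdy u (φ y, y) * deriv φ y =
    - c y * Real.sqrt (1 + gradSq u (φ y, y)) * Real.sqrt (1 + (deriv φ y) ^ 2))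

/-- The `y`-average `v̄(x) = (1/ε) ∫₀^ε v(x,y) dy`. -/
def ybar (ε : ℝ) (v : ℝ × ℝ → ℝ) (x : ℝ) : ℝ := (1 / ε) * ∫ y in Ioo (0 : ℝ) ε, v (x, y)

/-- The cosine of the apparent contact angle,
`cos θₐ = (1/ε) ∫₀^ε c(y) √(1 + φ'(y)²) dy`. -/
def cosA (ε : ℝ) (φ c : ℝ → ℝ) : ℝ :=
  (1 / ε) * ∫ y in Ioo (0 : ℝ) ε, c y * Real.sqrt (1 + (deriv φ y) ^ 2)

/-- The one-dimensional energy `E_β(w) = ∫₀¹ √(1 + w'(x)²) dx − β w(0)`. -/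
def En1 (β : ℝ) (w : ℝ → ℝ) : ℝ :=
  (∫ x in Ioo (0 : ℝ) 1, Real.sqrt (1 + (deriv w x) ^ 2)) - w 0 * β

/-- The standard context hypotheses on the data `ε, ν, H, φ, c`. -/
def Ctx (ε ν H : ℝ) (φ c : ℝ → ℝ) : Prop :=
  ε ∈ Ioc (0 : ℝ) 1 ∧ ν ∈ Ico (0 : ℝ) 1 ∧ 0 ≤ H ∧
  ContDiff ℝ 1 φ ∧ (∀ y, φ (y + ε) = φ y) ∧
  (∀ y, -(ε * H) ≤ φ y) ∧ (∀ y, φ y ≤ 0) ∧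
  Continuous c ∧ (∀ y, c (y + ε) = c y) ∧
  (∀ y, |c y| * Real.sqrt (1 + (deriv φ y) ^ 2) ≤ ν)

/-- The oscillation of a Lipschitz function on an interval is at most the integral of the
absolute value of its derivative. -/
theorem LipschitzWith.abs_sub_le_setIntegral_abs {f d : ℝ → ℝ} {K : NNReal}
    (hf : LipschitzWith K f) (hd : ∀ᵐ t, HasDerivAt f (d t) t) {a b s t : ℝ}
    (hs : s ∈ Icc a b) (ht : t ∈ Icc a b) :
    |f s - f t| ≤ ∫ r in Ioo a b, |d r| := by
  wlog hst : s ≤ t generalizing s t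
  · rw [abs_sub_comm]
    exact this ht hs (le_of_not_ge hst)
  have hderiv : d =ᵐ[volume] deriv f := by
    filter_upwards [hd] with r hr using hr.deriv.symm
  have hint : IntegrableOn (fun r => |d r|) (Ioc a b) := by
    have hac : AbsolutelyContinuousOnInterval f a b :=
      hf.lipschitzOnWith.absolutelyContinuousOnInterval
    have h := hac.intervalIntegrable_deriv.1.abs
    exact h.congr (ae_restrict_of_ae (by filter_upwards [hderiv] with r hr using by simp [hr]))
  have hac : AbsolutelyContinuousOnInterval f s t :=
    hf.lipschitzOnWith.absolutelyContinuousOnInterval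
  have hftc := hac.integral_deriv_eq_sub
  calc |f s - f t| = ‖∫ r in s..t, deriv f r‖ := by rw [hftc, abs_sub_comm, Real.norm_eq_abs]
    _ ≤ ∫ r in s..t, ‖deriv f r‖ := intervalIntegral.norm_integral_le_integral_norm hst
    _ = ∫ r in Ioc s t, |d r| := by
        rw [intervalIntegral.integral_of_le hst]
        refine integral_congr_ae (ae_restrict_of_ae ?_)
        filter_upwards [hderiv] with r hr using by simp [hr]
    _ ≤ ∫ r in Ioc a b, |d r| :=
        setIntegral_mono_set hint (Filter.Eventually.of_forall fun _ => abs_nonneg _)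
          (Ioc_subset_Ioc hs.1 ht.2).eventuallyLE
    _ = ∫ r in Ioo a b, |d r| := integral_Ioc_eq_integral_Ioo

theorem measurable_pdx (g : ℝ × ℝ → ℝ) : Measurable (pdx g) :=
  measurable_fderiv_apply_const ℝ g (1, 0)

theorem measurable_pdy (g : ℝ × ℝ → ℝ) : Measurable (pdy g) :=
  measurable_fderiv_apply_const ℝ g (0, 1)

theorem LipschitzWith.abs_pdx_le {g : ℝ × ℝ → ℝ} {K : NNReal} (hg : LipschitzWith K g)
    (p : ℝ × ℝ) : |pdx g p| ≤ K := by
  have h := (fderiv ℝ g p).le_opNorm (1, 0)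
  have h' := norm_fderiv_le_of_lipschitz ℝ (x₀ := p) hg
  simp [Prod.norm_def] at h
  exact h.trans h'

theorem LipschitzWith.abs_pdy_le {g : ℝ × ℝ → ℝ} {K : NNReal} (hg : LipschitzWith K g)
    (p : ℝ × ℝ) : |pdy g p| ≤ K := by
  have h := (fderiv ℝ g p).le_opNorm (0, 1)
  have h' := norm_fderiv_le_of_lipschitz ℝ (x₀ := p) hg
  simp [Prod.norm_def] at h
  exact h.trans h'

/-- For almost every `y`, the partial derivative `pdx g` is a.e. the derivative of the horizontal
slice of a Lipschitz function `g`. -/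
theorem LipschitzWith.ae_ae_hasDerivAt_pdx {g : ℝ × ℝ → ℝ} {K : NNReal}
    (hg : LipschitzWith K g) :
    ∀ᵐ y, ∀ᵐ x, HasDerivAt (fun x => g (x, y)) (pdx g (x, y)) x := by
  have h : ∀ᵐ p : ℝ × ℝ ∂(volume.prod volume), DifferentiableAt ℝ g p :=
    hg.ae_differentiableAt
  have h' := Measure.ae_ae_of_ae_prod
    (Measure.measurePreserving_swap.quasiMeasurePreserving.ae h)
  filter_upwards [h'] with y hy
  filter_upwards [hy] with x hx
  exact hx.hasFDerivAt.comp_hasDerivAt x ((hasDerivAt_id x).prodMk (hasDerivAt_const x y))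

/-- For almost every `x`, the partial derivative `pdy g` is a.e. the derivative of the vertical
slice of a Lipschitz function `g`. -/
theorem LipschitzWith.ae_ae_hasDerivAt_pdy {g : ℝ × ℝ → ℝ} {K : NNReal}
    (hg : LipschitzWith K g) :
    ∀ᵐ x, ∀ᵐ y, HasDerivAt (fun y => g (x, y)) (pdy g (x, y)) y := by
  have h : ∀ᵐ p : ℝ × ℝ ∂(volume.prod volume), DifferentiableAt ℝ g p :=
    hg.ae_differentiableAt
  filter_upwards [Measure.ae_ae_of_ae_prod h] with x hx
  filter_upwards [hx] with y hy
  exact hy.hasFDerivAt.comp_hasDerivAt y ((hasDerivAt_const y x).prodMk (hasDerivAt_id y))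

theorem isOpen_Dom {ε : ℝ} {φ : ℝ → ℝ} (hφ : Continuous φ) : IsOpen (Dom ε φ) :=
  (isOpen_lt (hφ.comp continuous_snd) continuous_fst).inter
    ((isOpen_lt continuous_fst continuous_const).inter
      ((isOpen_lt continuous_const continuous_snd).inter
        (isOpen_lt continuous_snd continuous_const)))

theorem volume_Dom_lt_top {ε M : ℝ} {φ : ℝ → ℝ} (hM : ∀ y, M ≤ φ y) :
    volume (Dom ε φ) < ⊤ := by
  have hsub : Dom ε φ ⊆ Icc M 1 ×ˢ Icc 0 ε := fun p hp =>
    ⟨⟨(hM p.2).trans hp.1.le, hp.2.1.le⟩, hp.2.2.1.le, hp.2.2.2.le⟩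
  exact (measure_mono hsub).trans_lt (isCompact_Icc.prod isCompact_Icc).measure_lt_top

theorem integrableOn_of_measurable_of_abs_le {α : Type*} [MeasurableSpace α] {μ : Measure α}
    {s : Set α} (hs : μ s < ⊤) {f : α → ℝ} (hf : Measurable f) {C : ℝ} (hC : ∀ a, |f a| ≤ C) :
    IntegrableOn f s μ :=
  Measure.integrableOn_of_bounded hs.ne hf.aestronglyMeasurable
    (Filter.Eventually.of_forall hC)

/-- Fubini's theorem on the domain `D`, with horizontal inner integrals. -/
theorem setIntegral_Dom {ε : ℝ} {φ : ℝ → ℝ} (hφ : Continuous φ) {f : ℝ × ℝ → ℝ}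
    (hf : IntegrableOn f (Dom ε φ)) :
    IntegrableOn (fun y => ∫ x in Ioo (φ y) 1, f (x, y)) (Ioo 0 ε) ∧
      ∫ p in Dom ε φ, f p = ∫ y in Ioo 0 ε, ∫ x in Ioo (φ y) 1, f (x, y) := by
  have hD : MeasurableSet (Dom ε φ) := (isOpen_Dom hφ).measurableSet
  have hint : Integrable ((Dom ε φ).indicator f) (volume.prod volume) :=
    hf.integrable_indicator hD
  have hslice : (fun y => ∫ x, (Dom ε φ).indicator f (x, y)) =
      (Ioo 0 ε).indicator fun y => ∫ x in Ioo (φ y) 1, f (x, y) := by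
    funext y
    by_cases hy : y ∈ Ioo 0 ε
    · rw [indicator_of_mem hy, ← integral_indicator measurableSet_Ioo]
      refine integral_congr_ae (Filter.Eventually.of_forall fun x => ?_)
      by_cases hx : x ∈ Ioo (φ y) 1
      · have : (x, y) ∈ Dom ε φ := ⟨hx.1, hx.2, hy.1, hy.2⟩
        simp [hx, this]
      · have : (x, y) ∉ Dom ε φ := fun h => hx ⟨h.1, h.2.1⟩
        simp only [indicator_of_notMem hx, indicator_of_notMem this]
    · rw [indicator_of_notMem hy]
      refine integral_eq_zero_of_ae (Filter.Eventually.of_forall fun x => ?_)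
      exact indicator_of_notMem (fun h => hy h.2.2) f
  constructor
  · have h := hint.integral_prod_right
    rw [hslice] at h
    exact (integrable_indicator_iff measurableSet_Ioo).1 h
  · rw [← integral_indicator hD, ← integral_indicator measurableSet_Ioo, ← hslice]
    exact integral_prod_symm _ hint

/-- The wetting energy is controlled by the total variation of `v` in the `x`-direction. -/
theorem setIntegral_boundary_le {ε ν M : ℝ} {φ c : ℝ → ℝ} {g : ℝ × ℝ → ℝ} {K : NNReal}
    (hφ : ContDiff ℝ 1 φ) (hM : ∀ y, M ≤ φ y) (hφ0 : ∀ y, φ y ≤ 0) (hc : Continuous c)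
    (hcν : ∀ y, |c y| * √(1 + deriv φ y ^ 2) ≤ ν) (hν : 0 ≤ ν)
    (hg : LipschitzWith K g) (hg1 : ∀ y, g (1, y) = 0) :
    ∫ y in Ioo 0 ε, g (φ y, y) * c y * √(1 + deriv φ y ^ 2) ≤
      ν * ∫ p in Dom ε φ, |pdx g p| := by
  obtain ⟨hint, heq⟩ := setIntegral_Dom (ε := ε) hφ.continuous
    (integrableOn_of_measurable_of_abs_le (volume_Dom_lt_top hM) (measurable_pdx g).abs
      (fun p => (abs_abs (pdx g p)).le.trans (hg.abs_pdx_le p)))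
  rw [heq, ← integral_const_mul]
  have hcont : Continuous fun y => g (φ y, y) * c y * √(1 + deriv φ y ^ 2) := by
    have h1 := hg.continuous
    have h2 := hφ.continuous
    have h3 := hφ.continuous_deriv le_rfl
    fun_prop
  refine integral_mono_ae ((hcont.integrableOn_Icc (a := 0) (b := ε)).mono_set
    Ioo_subset_Icc_self) (hint.const_mul ν) (ae_restrict_of_ae ?_)
  filter_upwards [hg.ae_ae_hasDerivAt_pdx] with y hy
  have hlip : LipschitzWith K fun x => g (x, y) := by
    simpa [Function.comp_def] using hg.comp (LipschitzWith.prodMk_right y)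
  have hφ1 : φ y ≤ 1 := (hφ0 y).trans zero_le_one
  have h := hlip.abs_sub_le_setIntegral_abs hy (left_mem_Icc.2 hφ1) (right_mem_Icc.2 hφ1)
  rw [hg1, sub_zero] at h
  calc g (φ y, y) * c y * √(1 + deriv φ y ^ 2)
      ≤ |g (φ y, y) * c y * √(1 + deriv φ y ^ 2)| := le_abs_self _
    _ = (|c y| * √(1 + deriv φ y ^ 2)) * |g (φ y, y)| := by
        rw [abs_mul, abs_mul, abs_of_nonneg (Real.sqrt_nonneg _)]; ring
    _ ≤ ν * ∫ x in Ioo (φ y) 1, |pdx g (x, y)| := by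
        gcongr
        exact hcν y

/-- The deviation from the mean is controlled by the total variation of `v` in the
`y`-direction. -/
theorem setIntegral_abs_sub_ybar_le {ε M : ℝ} {φ : ℝ → ℝ} {v g : ℝ × ℝ → ℝ} {K : NNReal}
    (hε : 0 < ε) (hM : ∀ y, M ≤ φ y) (hφ0 : ∀ y, φ y ≤ 0)
    (hg : LipschitzWith K g) (hvg : EqOn v g (DomBar φ)) {y : ℝ} (hy : y ∈ Ioo 0 ε) :
    ∫ x in Ioo (0 : ℝ) 1, |v (x, y) - ybar ε v x| ≤ ∫ p in Dom ε φ, |pdy g p| := by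
  have hint : IntegrableOn (fun p => |pdy g p|) (Dom ε φ) :=
    integrableOn_of_measurable_of_abs_le (volume_Dom_lt_top hM) (measurable_pdy g).abs
      (fun p => (abs_abs (pdy g p)).le.trans (hg.abs_pdy_le p))
  have hsub : Ioo (0 : ℝ) 1 ×ˢ Ioo 0 ε ⊆ Dom ε φ := fun p hp =>
    ⟨(hφ0 p.2).trans_lt hp.1.1, hp.1.2, hp.2.1, hp.2.2⟩
  have hrect : IntegrableOn (fun p => |pdy g p|) (Ioo (0 : ℝ) 1 ×ˢ Ioo 0 ε)
      (volume.prod volume) := hint.mono_set hsub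
  have hfub := setIntegral_prod _ hrect
  refine le_trans ?_ (setIntegral_mono_set hint
    (Filter.Eventually.of_forall fun _ => abs_nonneg _) hsub.eventuallyLE)
  refine le_trans ?_ hfub.ge
  have hinner : IntegrableOn (fun x => ∫ t in Ioo 0 ε, |pdy g (x, t)|) (Ioo (0 : ℝ) 1) := by
    rw [IntegrableOn, ← Measure.prod_restrict] at hrect
    exact hrect.integral_prod_left
  refine integral_mono_of_nonneg (Filter.Eventually.of_forall fun _ => abs_nonneg _) hinner ?_
  filter_upwards [ae_restrict_mem measurableSet_Ioo,
    ae_restrict_of_ae hg.ae_ae_hasDerivAt_pdy] with x hx hder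
  have hlip : LipschitzWith K fun t => g (x, t) := by
    simpa [Function.comp_def] using hg.comp (LipschitzWith.prodMk_left x)
  have hgv : ∀ t, v (x, t) = g (x, t) := fun t => hvg ⟨(hφ0 t).trans hx.1.le, hx.2.le⟩
  have hintg : IntegrableOn (fun t => g (x, t)) (Ioo 0 ε) :=
    (hlip.continuous.integrableOn_Icc (a := 0) (b := ε)).mono_set Ioo_subset_Icc_self
  have hvol : volume.real (Ioo 0 ε) = ε := by simp [hε.le]
  have hmean : v (x, y) - ybar ε v x = (1 / ε) * ∫ t in Ioo 0 ε, (g (x, y) - g (x, t)) := by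
    rw [integral_sub (by simp) hintg, setIntegral_const, hvol, ybar]
    simp only [hgv, smul_eq_mul]
    field_simp
  have hbound := norm_setIntegral_le_of_norm_le_const (μ := volume) (s := Ioo 0 ε)
    (f := fun t => g (x, y) - g (x, t)) (C := ∫ t in Ioo 0 ε, |pdy g (x, t)|) (by simp)
    (fun t ht => hlip.abs_sub_le_setIntegral_abs hder (Ioo_subset_Icc_self hy)
      (Ioo_subset_Icc_self ht))
  rw [hvol, Real.norm_eq_abs] at hbound
  simp only [hmean, abs_mul, abs_of_pos (one_div_pos.2 hε)]
  rw [one_div, inv_mul_le_iff₀ hε, mul_comm ε]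
  exact hbound

/-- Lemma 5.2: for every `v ∈ V` and every `y ∈ (0,ε)`,
`∫₀¹ |v(x,y) − v̄(x)| dx ≤ ε 𝓔(v)/(1−ν)`. -/
theorem average_deviation_estimate
    (ε ν H : ℝ) (φ c : ℝ → ℝ) (hctx : Ctx ε ν H φ c)
    (v : ℝ × ℝ → ℝ) (hv : memV ε φ v) :
    ∀ y ∈ Ioo (0 : ℝ) ε,
      (∫ x in Ioo (0 : ℝ) 1, |v (x, y) - ybar ε v x|) ≤ ε * En ε φ c v / (1 - ν) := by
  intro y hy
  obtain ⟨⟨hε, -⟩, ⟨hν, hν1⟩, -, hφ, -, hM, hφ0, hc, -, hcν⟩ := hctx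
  obtain ⟨⟨K, hK⟩, -, hv1⟩ := hv
  obtain ⟨g, hg, hvg⟩ := hK.extend_real
  have hD := isOpen_Dom (ε := ε) hφ.continuous
  have hfin := volume_Dom_lt_top (ε := ε) hM
  have hgrad : ∀ p ∈ Dom ε φ, gradSq v p = gradSq g p := by
    intro p hp
    have hev : v =ᶠ[nhds p] g := by
      filter_upwards [hD.mem_nhds hp] with q hq using hvg ⟨hq.1.le, hq.2.1.le⟩
    simp only [gradSq, pdx, pdy, hev.fderiv_eq]
  have harea : ∫ p in Dom ε φ, √(1 + gradSq v p) = ∫ p in Dom ε φ, √(1 + gradSq g p) :=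
    setIntegral_congr_fun hD.measurableSet fun p hp => by simp only [hgrad p hp]
  have hbdry : ∫ y in Ioo 0 ε, v (φ y, y) * c y * √(1 + deriv φ y ^ 2) =
      ∫ y in Ioo 0 ε, g (φ y, y) * c y * √(1 + deriv φ y ^ 2) := by
    refine setIntegral_congr_fun measurableSet_Ioo fun t _ => ?_
    simp only [hvg (show (φ t, t) ∈ DomBar φ from ⟨le_rfl, (hφ0 t).trans zero_le_one⟩)]
  have hg1 : ∀ t, g (1, t) = 0 := fun t => by
    rw [← hvg (show (1, t) ∈ DomBar φ from ⟨(hφ0 t).trans zero_le_one, le_rfl⟩), hv1]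
  have hwet := setIntegral_boundary_le (ε := ε) hφ hM hφ0 hc hcν hν hg hg1
  have hdev := setIntegral_abs_sub_ybar_le hε hM hφ0 hg hvg hy
  have hintx : IntegrableOn (fun p => |pdx g p|) (Dom ε φ) :=
    integrableOn_of_measurable_of_abs_le hfin (measurable_pdx g).abs
      (fun p => (abs_abs (pdx g p)).le.trans (hg.abs_pdx_le p))
  have hinty : IntegrableOn (fun p => |pdy g p|) (Dom ε φ) :=
    integrableOn_of_measurable_of_abs_le hfin (measurable_pdy g).abs
      (fun p => (abs_abs (pdy g p)).le.trans (hg.abs_pdy_le p))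
  have hintarea : IntegrableOn (fun p => √(1 + gradSq g p)) (Dom ε φ) := by
    refine integrableOn_of_measurable_of_abs_le hfin (C := √(1 + (K ^ 2 + K ^ 2))) ?_ fun p => ?_
    · exact (((measurable_pdx g).pow_const 2).add
        ((measurable_pdy g).pow_const 2)).const_add 1 |>.sqrt
    · rw [abs_of_nonneg (Real.sqrt_nonneg _)]
      refine Real.sqrt_le_sqrt ?_
      have hx := pow_le_pow_left₀ (abs_nonneg _) (hg.abs_pdx_le p) 2
      have hy := pow_le_pow_left₀ (abs_nonneg _) (hg.abs_pdy_le p) 2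
      rw [sq_abs] at hx hy
      unfold gradSq
      linarith
  have hsplit : ν * (∫ p in Dom ε φ, |pdx g p|) + (1 - ν) * ∫ p in Dom ε φ, |pdy g p| ≤
      ∫ p in Dom ε φ, √(1 + gradSq g p) := by
    rw [← integral_const_mul, ← integral_const_mul,
      ← integral_add (hintx.const_mul ν) (hinty.const_mul (1 - ν))]
    refine integral_mono ((hintx.const_mul ν).add (hinty.const_mul (1 - ν))) hintarea fun p => ?_
    have hx : |pdx g p| ≤ √(1 + gradSq g p) :=
      Real.abs_le_sqrt (by unfold gradSq; nlinarith [sq_nonneg (pdy g p)])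
    have hy : |pdy g p| ≤ √(1 + gradSq g p) :=
      Real.abs_le_sqrt (by unfold gradSq; nlinarith [sq_nonneg (pdx g p)])
    have h1 := mul_le_mul_of_nonneg_left hx hν
    have h2 := mul_le_mul_of_nonneg_left hy (sub_nonneg.2 hν1.le)
    linarith
  have henergy : ε * En ε φ c v = (∫ p in Dom ε φ, √(1 + gradSq g p)) -
      ∫ y in Ioo 0 ε, g (φ y, y) * c y * √(1 + deriv φ y ^ 2) := by
    rw [En, harea, hbdry]
    field_simp
  rw [le_div_iff₀ (sub_pos.2 hν1), henergy]
  have h := mul_le_mul_of_nonneg_right hdev (sub_nonneg.2 hν1.le)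
  linarith
end
end

section
/- (Lemma 5.4) Suppose u ∈ V is a minimizer of 𝓔 over V, i.e. 𝓔(u) ≤ 𝓔(v) for all v ∈ V. Then E(ū) ≤ 𝓔(u) + (2ν/(1−ν))·(1+H)·ε, where ū(x) = (1/ε)∫₀^ε u(x,y) dy is the y-average of u (a Lipschitz function on [0,1] with ū(1) = 0). -/
open MeasureTheory Set

noncomputable section

/-- Real functions on the plane that are measurable and bounded. -/
def BddMeas (F : ℝ × ℝ → ℝ) : Prop := Measurable F ∧ ∃ C : ℝ, ∀ p, |F p| ≤ C

theorem Measurable.intervalIntegrable_of_bdd {f : ℝ → ℝ} (hf : Measurable f) {C : ℝ}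
    (hC : ∀ x, |f x| ≤ C) (a b : ℝ) : IntervalIntegrable f volume a b :=
  (intervalIntegrable_const (c := C)).mono_fun' hf.aestronglyMeasurable
    (Filter.Eventually.of_forall hC)

theorem measurableSet_dom {ε : ℝ} {φ : ℝ → ℝ} (hφ : Continuous φ) :
    MeasurableSet (Dom ε φ) :=
  (measurableSet_lt (by fun_prop) measurable_fst).inter
    ((measurableSet_lt measurable_fst measurable_const).inter
    ((measurableSet_lt measurable_const measurable_snd).inter
      (measurableSet_lt measurable_snd measurable_const)))

namespace BddMeas

variable {F G : ℝ × ℝ → ℝ}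

theorem intervalIntegrable_fst (hF : BddMeas F) (y a b : ℝ) :
    IntervalIntegrable (fun x => F (x, y)) volume a b := by
  obtain ⟨hm, C, hC⟩ := hF
  exact (hm.comp (by fun_prop : Measurable fun x : ℝ => (x, y))).intervalIntegrable_of_bdd
    (fun x => hC _) a b

theorem intervalIntegrable_snd (hF : BddMeas F) (x a b : ℝ) :
    IntervalIntegrable (fun y => F (x, y)) volume a b := by
  obtain ⟨hm, C, hC⟩ := hF
  exact (hm.comp (by fun_prop : Measurable fun y : ℝ => (x, y))).intervalIntegrable_of_bdd
    (fun x => hC _) a b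

theorem abs (hF : BddMeas F) : BddMeas (fun p => |F p|) := by
  obtain ⟨hm, C, hC⟩ := hF
  exact ⟨by fun_prop, C, fun p => by simpa using hC p⟩

theorem mul (hF : BddMeas F) (hG : BddMeas G) : BddMeas (fun p => F p * G p) := by
  obtain ⟨hm, C, hC⟩ := hF
  obtain ⟨hm', C', hC'⟩ := hG
  refine ⟨hm.mul hm', C * C', fun p => ?_⟩
  rw [abs_mul]
  exact mul_le_mul (hC p) (hC' p) (abs_nonneg _) ((abs_nonneg _).trans (hC p))

theorem swap (hF : BddMeas F) : BddMeas (fun p => F p.swap) :=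
  ⟨hF.1.comp measurable_swap, hF.2.imp fun _ h _ => h _⟩

theorem intervalIntegrable_slice (hF : BddMeas F) {a b : ℝ → ℝ} (ha : Continuous a)
    (hb : Continuous b) (hab : ∀ y, a y ≤ b y) (c d : ℝ) :
    IntervalIntegrable (fun y => ∫ x in a y..b y, F (x, y)) volume c d := by
  obtain ⟨hm, C, hC⟩ := hF
  set S : Set (ℝ × ℝ) := {p | a p.2 < p.1 ∧ p.1 ≤ b p.2} with hS
  have hSm : MeasurableSet S :=
    (measurableSet_lt (by fun_prop) measurable_fst).inter
      (measurableSet_le measurable_fst (by fun_prop))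
  have heq : (fun y => ∫ x in a y..b y, F (x, y)) = fun y => ∫ x, S.indicator F (x, y) := by
    ext y
    rw [intervalIntegral.integral_of_le (hab y), ← integral_indicator measurableSet_Ioc]
    rfl
  have hmeas : StronglyMeasurable (fun y => ∫ x in a y..b y, F (x, y)) := by
    rw [heq]
    exact StronglyMeasurable.integral_prod_left (f := fun x y => S.indicator F (x, y))
      (hm.indicator hSm).stronglyMeasurable
  refine (Continuous.intervalIntegrable (u := fun y => C * |b y - a y|) (by fun_prop) c d).mono_fun'
    hmeas.aestronglyMeasurable (Filter.Eventually.of_forall fun y => ?_)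
  exact intervalIntegral.norm_integral_le_of_norm_le_const fun x _ => hC (x, y)

theorem setIntegral_dom (hF : BddMeas F) {ε : ℝ} (hε : 0 < ε) {φ : ℝ → ℝ} (hφ : Continuous φ)
    (hφ1 : ∀ y, φ y ≤ 1) :
    IntegrableOn F (Dom ε φ) ∧
    ∫ p in Dom ε φ, F p = ∫ y in (0 : ℝ)..ε, ∫ x in φ y..1, F (x, y) := by
  obtain ⟨hm, C, hC⟩ := hF
  have hD := measurableSet_dom (ε := ε) hφ
  obtain ⟨m, hmφ⟩ := (isCompact_Icc (a := (0 : ℝ)) (b := ε)).bddBelow_image hφ.continuousOn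
  have hsub : Dom ε φ ⊆ Icc m 1 ×ˢ Icc 0 ε := by
    rintro ⟨x, y⟩ ⟨h1, h2, h3, h4⟩
    exact ⟨⟨(hmφ ⟨y, ⟨h3.le, h4.le⟩, rfl⟩).trans h1.le, h2.le⟩, h3.le, h4.le⟩
  have hfin : volume (Dom ε φ) ≠ ⊤ :=
    ((measure_mono hsub).trans_lt (isCompact_Icc.prod isCompact_Icc).measure_lt_top).ne
  have hint : IntegrableOn F (Dom ε φ) :=
    Measure.integrableOn_of_bounded hfin hm.aestronglyMeasurable
      (Filter.Eventually.of_forall hC)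
  refine ⟨hint, ?_⟩
  rw [← integral_indicator hD, Measure.volume_eq_prod, integral_prod_symm _
    ((integrable_indicator_iff hD).2 hint), intervalIntegral.integral_of_le hε.le,
    integral_Ioc_eq_integral_Ioo, ← integral_indicator measurableSet_Ioo]
  congr 1
  ext y
  by_cases hy : y ∈ Ioo 0 ε
  · rw [indicator_of_mem hy, intervalIntegral.integral_of_le (hφ1 y),
      integral_Ioc_eq_integral_Ioo, ← integral_indicator measurableSet_Ioo]
    congr 1
    ext x
    by_cases hx : x ∈ Ioo (φ y) 1
    · rw [indicator_of_mem hx, indicator_of_mem]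
      exact ⟨hx.1, hx.2, hy.1, hy.2⟩
    · rw [indicator_of_notMem hx, indicator_of_notMem]
      exact fun h => hx ⟨h.1, h.2.1⟩
  · rw [indicator_of_notMem hy]
    have : ∀ x, (Dom ε φ).indicator F (x, y) = 0 := fun x =>
      indicator_of_notMem (fun h => hy ⟨h.2.2.1, h.2.2.2⟩) _
    simp [this]

theorem integral_swap (hF : BddMeas F) {a b c d : ℝ} (hab : a ≤ b) (hcd : c ≤ d) :
    ∫ x in a..b, ∫ y in c..d, F (x, y) = ∫ y in c..d, ∫ x in a..b, F (x, y) := by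
  obtain ⟨hm, C, hC⟩ := hF
  simp only [intervalIntegral.integral_of_le hab, intervalIntegral.integral_of_le hcd]
  refine integral_integral_swap (f := fun x y => F (x, y)) ?_
  exact Integrable.of_bound hm.aestronglyMeasurable C (Filter.Eventually.of_forall hC)

end BddMeas

section Gradient

variable {g : ℝ × ℝ → ℝ} {K : NNReal}

theorem LipschitzWith.bddMeas_pdx (hg : LipschitzWith K g) : BddMeas (pdx g) := by
  refine ⟨measurable_fderiv_apply_const ℝ g _, K, fun p => ?_⟩
  have h := (fderiv ℝ g p).le_of_opNorm_le (norm_fderiv_le_of_lipschitz ℝ hg (x₀ := p)) (1, 0)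
  simpa [pdx, Prod.norm_def] using h

theorem LipschitzWith.bddMeas_pdy (hg : LipschitzWith K g) : BddMeas (pdy g) := by
  refine ⟨measurable_fderiv_apply_const ℝ g _, K, fun p => ?_⟩
  have h := (fderiv ℝ g p).le_of_opNorm_le (norm_fderiv_le_of_lipschitz ℝ hg (x₀ := p)) (0, 1)
  simpa [pdy, Prod.norm_def] using h

/-- The area integrand `√(1 + |∇v|²)`. -/
def areaDensity (v : ℝ × ℝ → ℝ) (p : ℝ × ℝ) : ℝ := Real.sqrt (1 + gradSq v p)

theorem one_le_areaDensity (v : ℝ × ℝ → ℝ) (p : ℝ × ℝ) : 1 ≤ areaDensity v p :=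
  Real.one_le_sqrt.2 (by unfold gradSq; nlinarith [sq_nonneg (pdx v p), sq_nonneg (pdy v p)])

theorem areaDensity_sq (v : ℝ × ℝ → ℝ) (p : ℝ × ℝ) :
    areaDensity v p ^ 2 = 1 + pdx v p ^ 2 + pdy v p ^ 2 := by
  rw [areaDensity, Real.sq_sqrt (by unfold gradSq; positivity), gradSq, add_assoc]

theorem abs_pdx_le_areaDensity (v : ℝ × ℝ → ℝ) (p : ℝ × ℝ) : |pdx v p| ≤ areaDensity v p :=
  abs_le_of_sq_le_sq (by rw [areaDensity_sq]; nlinarith [sq_nonneg (pdy v p)])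
    (zero_le_one.trans (one_le_areaDensity v p))

theorem LipschitzWith.bddMeas_areaDensity (hg : LipschitzWith K g) :
    BddMeas (areaDensity g) := by
  obtain ⟨hx, C, hC⟩ := hg.bddMeas_pdx
  obtain ⟨hy, C', hC'⟩ := hg.bddMeas_pdy
  refine ⟨by unfold areaDensity gradSq; fun_prop, 1 + C + C', fun p => ?_⟩
  have h0 := areaDensity_sq g p
  have h1 := one_le_areaDensity g p
  have := hC p
  have := hC' p
  have := abs_nonneg (pdx g p)
  have := abs_nonneg (pdy g p)
  rw [abs_of_nonneg (by linarith)]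
  refine abs_le_of_sq_le_sq' ?_ (by linarith) |>.2
  rw [h0, ← sq_abs (pdx g p), ← sq_abs (pdy g p)]
  nlinarith

theorem LipschitzWith.integral_deriv_eq_sub {f : ℝ → ℝ} (hf : LipschitzWith K f) (a b : ℝ) :
    ∫ x in a..b, deriv f x = f b - f a :=
  (hf.lipschitzOnWith (s := uIcc a b)).absolutelyContinuousOnInterval.integral_deriv_eq_sub

theorem LipschitzWith.fst_slice (hg : LipschitzWith K g) (y : ℝ) :
    LipschitzWith K fun x => g (x, y) := by
  simpa [Function.comp_def] using hg.comp (LipschitzWith.prodMk_right y)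

theorem LipschitzWith.snd_slice (hg : LipschitzWith K g) (x : ℝ) :
    LipschitzWith K fun y => g (x, y) := by
  simpa [Function.comp_def] using hg.comp (LipschitzWith.prodMk_left x)

theorem hasDerivAt_fst_slice {x y : ℝ} (h : DifferentiableAt ℝ g (x, y)) :
    HasDerivAt (fun t => g (t, y)) (pdx g (x, y)) x :=
  h.hasFDerivAt.comp_hasDerivAt x ((hasDerivAt_id x).prodMk (hasDerivAt_const x y))

theorem hasDerivAt_snd_slice {x y : ℝ} (h : DifferentiableAt ℝ g (x, y)) :
    HasDerivAt (fun t => g (x, t)) (pdy g (x, y)) y :=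
  h.hasFDerivAt.comp_hasDerivAt y ((hasDerivAt_const y x).prodMk (hasDerivAt_id y))

theorem LipschitzWith.ae_ae_differentiableAt_snd (hg : LipschitzWith K g) :
    ∀ᵐ x : ℝ, ∀ᵐ y : ℝ, DifferentiableAt ℝ g (x, y) :=
  Measure.ae_ae_of_ae_prod (μ := volume) (ν := volume)
    (p := fun p => DifferentiableAt ℝ g p) (hg.ae_differentiableAt (μ := volume))

theorem LipschitzWith.ae_ae_differentiableAt_fst (hg : LipschitzWith K g) :
    ∀ᵐ y : ℝ, ∀ᵐ x : ℝ, DifferentiableAt ℝ g (x, y) :=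
  (Measure.ae_ae_comm (measurableSet_of_differentiableAt ℝ g)).1 hg.ae_ae_differentiableAt_snd

theorem LipschitzWith.ae_integral_pdx (hg : LipschitzWith K g) :
    ∀ᵐ y : ℝ, ∀ a b, ∫ x in a..b, pdx g (x, y) = g (b, y) - g (a, y) := by
  filter_upwards [hg.ae_ae_differentiableAt_fst] with y hy a b
  rw [← (hg.fst_slice y).integral_deriv_eq_sub a b]
  refine intervalIntegral.integral_congr_ae ?_
  filter_upwards [hy] with x hx _
  exact (hasDerivAt_fst_slice hx).deriv.symm

theorem LipschitzWith.ae_integral_pdy (hg : LipschitzWith K g) :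
    ∀ᵐ x : ℝ, ∀ a b, ∫ y in a..b, pdy g (x, y) = g (x, b) - g (x, a) := by
  filter_upwards [hg.ae_ae_differentiableAt_snd] with x hx a b
  rw [← (hg.snd_slice x).integral_deriv_eq_sub a b]
  refine intervalIntegral.integral_congr_ae ?_
  filter_upwards [hx] with y hy _
  exact (hasDerivAt_snd_slice hy).deriv.symm

end Gradient

theorem gradSq_congr {v w : ℝ × ℝ → ℝ} {p : ℝ × ℝ} (h : v =ᶠ[nhds p] w) :
    gradSq v p = gradSq w p := by
  simp only [gradSq, pdx, pdy, h.fderiv_eq]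

theorem gradSq_translate (v : ℝ × ℝ → ℝ) (a p : ℝ × ℝ) :
    gradSq (fun q => v (q + a)) p = gradSq v (p + a) := by
  simp only [gradSq, pdx, pdy, fderiv_comp_add_right]

theorem gradSq_const (k : ℝ) (p : ℝ × ℝ) : gradSq (fun _ => k) p = 0 := by
  simp [gradSq, pdx, pdy]

theorem domBar_mem_nhds {ε : ℝ} {φ : ℝ → ℝ} (hφ : Continuous φ) {p : ℝ × ℝ}
    (hp : p ∈ Dom ε φ) : DomBar φ ∈ nhds p := by
  have h1 : ∀ᶠ q : ℝ × ℝ in nhds p, φ q.2 < q.1 :=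
    (by fun_prop : Continuous fun q : ℝ × ℝ => φ q.2).continuousAt.eventually_lt
      continuous_fst.continuousAt hp.1
  have h2 : ∀ᶠ q : ℝ × ℝ in nhds p, q.1 < 1 :=
    continuous_fst.continuousAt.eventually_lt continuousAt_const hp.2.1
  filter_upwards [h1, h2] with q hq hq' using ⟨hq.le, hq'.le⟩

theorem En_eq_of_ae {ε : ℝ} (hε : 0 < ε) {φ c : ℝ → ℝ} (hφ : Continuous φ)
    (hφ1 : ∀ y, φ y ≤ 1) {v F : ℝ × ℝ → ℝ} (hF : BddMeas F)
    (hv : ∀ᵐ p, p ∈ Dom ε φ → Real.sqrt (1 + gradSq v p) = F p) :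
    En ε φ c v = (1 / ε) * ((∫ y in (0 : ℝ)..ε, ∫ x in φ y..1, F (x, y)) -
      ∫ y in (0 : ℝ)..ε, v (φ y, y) * (c y * Real.sqrt (1 + (deriv φ y) ^ 2))) := by
  have hD := measurableSet_dom (ε := ε) hφ
  rw [En, setIntegral_congr_ae hD hv, (hF.setIntegral_dom hε hφ hφ1).2, mul_sub,
    intervalIntegral.integral_of_le hε.le (f := fun y => v (φ y, y) * _),
    integral_Ioc_eq_integral_Ioo]
  simp only [mul_assoc]

theorem integral_shift_le {f : ℝ → ℝ} (hf : ∀ a b, IntervalIntegrable f volume a b)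
    {a s : ℝ} (ha : a ≤ 1) (hs : 0 ≤ s) :
    ∫ x in a..1, (if x + s ≤ 1 then f (x + s) else 1) ≤
      (∫ x in a..1, f x) - (∫ x in a..min (a + s) 1, f x) + s := by
  rcases le_total 1 (a + s) with h | h
  · rw [min_eq_right h]
    have : ∫ x in a..1, (if x + s ≤ 1 then f (x + s) else 1) = ∫ x in a..1, (1 : ℝ) := by
      refine intervalIntegral.integral_congr_ae (Filter.Eventually.of_forall fun x hx => ?_)
      rw [uIoc_of_le ha] at hx
      exact if_neg (by linarith [hx.1])
    rw [this, intervalIntegral.integral_const, smul_eq_mul]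
    linarith
  · rw [min_eq_left h]
    have h1 : EqOn (fun x => f (x + s)) (fun x => if x + s ≤ 1 then f (x + s) else 1)
        (uIoc a (1 - s)) := by
      intro x hx
      rw [uIoc_of_le (by linarith)] at hx
      exact (if_pos (by linarith [hx.2])).symm
    have h2 : EqOn (fun _ => (1 : ℝ)) (fun x => if x + s ≤ 1 then f (x + s) else 1)
        (uIoc (1 - s) 1) := by
      intro x hx
      rw [uIoc_of_le (by linarith)] at hx
      exact (if_neg (by linarith [hx.1])).symm
    have i1 : IntervalIntegrable (fun x => f (x + s)) volume a (1 - s) := by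
      simpa using (hf (a + s) (1 - s + s)).comp_add_right s
    rw [← intervalIntegral.integral_add_adjacent_intervals (i1.congr h1)
      (intervalIntegrable_const.congr h2),
      ← intervalIntegral.integral_congr_ae (Filter.Eventually.of_forall h1),
      ← intervalIntegral.integral_congr_ae (Filter.Eventually.of_forall h2),
      intervalIntegral.integral_comp_add_right, intervalIntegral.integral_const, smul_eq_mul,
      ← intervalIntegral.integral_add_adjacent_intervals (hf a (a + s)) (hf (a + s) 1)]
    simp

theorem memV_shift {ε s : ℝ} (hs : 0 ≤ s) {φ : ℝ → ℝ} (hφ1 : ∀ y, φ y ≤ 1)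
    {u : ℝ × ℝ → ℝ} (hu : memV ε φ u) : memV ε φ fun p => u (min (p.1 + s) 1, p.2) := by
  obtain ⟨⟨K, hK⟩, hper, hone⟩ := hu
  refine ⟨⟨_, hK.comp (((LipschitzWith.prod_fst.add (LipschitzWith.const s)).min_const
    1).prodMk LipschitzWith.prod_snd).lipschitzOnWith fun p hp => ?_⟩, fun x y => hper _ _,
    fun y => ?_⟩
  · exact ⟨le_min (by simpa using hp.1.trans (by linarith)) (hφ1 _), min_le_right _ _⟩
  · simpa [hs] using hone y

theorem ae_areaDensity_shift {ε s : ℝ} {φ : ℝ → ℝ} (hφ : Continuous φ) (hs : 0 ≤ s)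
    {u g : ℝ × ℝ → ℝ} (hone : ∀ y, u (1, y) = 0) (hug : EqOn u g (DomBar φ)) :
    ∀ᵐ p : ℝ × ℝ, p ∈ Dom ε φ →
      Real.sqrt (1 + gradSq (fun q => u (min (q.1 + s) 1, q.2)) p) =
        if p.1 + s ≤ 1 then areaDensity g (p.1 + s, p.2) else 1 := by
  have hnull : ∀ᵐ p : ℝ × ℝ, p.1 ≠ 1 - s := by
    have : volume ({1 - s} ×ˢ univ : Set (ℝ × ℝ)) = 0 := by
      rw [Measure.volume_eq_prod, Measure.prod_prod]
      simp
    rw [ae_iff]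
    refine measure_mono_null (fun p hp => ?_) this
    simpa using hp
  filter_upwards [hnull] with p hp hpD
  have hc : Continuous fun q : ℝ × ℝ => q.1 + s := by fun_prop
  rcases lt_or_gt_of_ne hp with h | h
  · rw [if_pos (by linarith), areaDensity,
      show (p.1 + s, p.2) = p + (s, 0) by ext <;> simp, ← gradSq_translate]
    congr 2
    refine gradSq_congr ?_
    filter_upwards [hc.continuousAt.eventually_lt continuousAt_const (by linarith : p.1 + s < 1),
      domBar_mem_nhds hφ hpD] with q hq hqD
    rw [min_eq_left hq.le, show q + (s, 0) = (q.1 + s, q.2) by ext <;> simp]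
    exact hug ⟨by simpa using hqD.1.trans (by linarith), hq.le⟩
  · rw [if_neg (by linarith)]
    have : (fun q : ℝ × ℝ => u (min (q.1 + s) 1, q.2)) =ᶠ[nhds p] fun _ => 0 := by
      filter_upwards [continuousAt_const.eventually_lt hc.continuousAt
        (by linarith : 1 < p.1 + s)] with q hq
      rw [min_eq_right hq.le, hone]
    rw [gradSq_congr this, gradSq_const]
    simp

theorem areaDensity_dom {ε : ℝ} {φ : ℝ → ℝ} (hφ : Continuous φ) {u g : ℝ × ℝ → ℝ}
    (hug : EqOn u g (DomBar φ)) {p : ℝ × ℝ} (hp : p ∈ Dom ε φ) :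
    Real.sqrt (1 + gradSq u p) = areaDensity g p := by
  rw [areaDensity, gradSq_congr (hug.eventuallyEq_of_mem (domBar_mem_nhds hφ hp))]

/-- Comparing a minimizer with its translate in the `x` direction bounds its energy in a strip
of width `s` along the left boundary. -/
theorem strip_estimate {ε ν s : ℝ} (hε : 0 < ε) (hs : 0 ≤ s) {φ c : ℝ → ℝ}
    (hφ : ContDiff ℝ 1 φ) (hφ1 : ∀ y, φ y ≤ 1) (hc : Continuous c)
    (hν : ∀ y, |c y * Real.sqrt (1 + (deriv φ y) ^ 2)| ≤ ν)
    {u g : ℝ × ℝ → ℝ} (hu : memV ε φ u)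
    (hmin : ∀ v, memV ε φ v → En ε φ c u ≤ En ε φ c v)
    {K : NNReal} (hg : LipschitzWith K g) (hug : EqOn u g (DomBar φ)) :
    ∫ y in (0 : ℝ)..ε, ∫ x in φ y..min (φ y + s) 1, (areaDensity g (x, y) - ν * |pdx g (x, y)|)
      ≤ s * ε := by
  have hW := hg.bddMeas_areaDensity
  have hP := hg.bddMeas_pdx.abs
  have hφc := hφ.continuous
  set C : ℝ → ℝ := fun y => c y * Real.sqrt (1 + (deriv φ y) ^ 2) with hC
  have hCc : Continuous C := by
    have := hφ.continuous_deriv le_rfl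
    fun_prop
  set b : ℝ → ℝ := fun y => min (φ y + s) 1 with hb
  have hbc : Continuous b := by fun_prop
  have hφb : ∀ y, φ y ≤ b y := fun y => le_min (by linarith) (hφ1 y)
  set F : ℝ × ℝ → ℝ := fun p => if p.1 + s ≤ 1 then areaDensity g (p.1 + s, p.2) else 1 with hF
  have hFb : BddMeas F := by
    obtain ⟨hm, M, hM⟩ := hW
    refine ⟨Measurable.ite (measurableSet_le (by fun_prop) measurable_const) (by fun_prop)
      measurable_const, max M 1, fun p => ?_⟩
    simp only [hF]
    split_ifs
    · exact (hM _).trans (le_max_left _ _)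
    · simp
  have hle := hmin _ (memV_shift hs hφ1 hu)
  rw [En_eq_of_ae hε hφc hφ1 hW (Filter.Eventually.of_forall fun p => areaDensity_dom hφc hug),
    En_eq_of_ae hε hφc hφ1 hFb (ae_areaDensity_shift hφc hs hu.2.2 hug)] at hle
  replace hle := le_of_mul_le_mul_left hle (by positivity)
  have e1 : ∀ y, u (φ y, y) = g (φ y, y) := fun y => hug ⟨le_rfl, hφ1 y⟩
  have e2 : ∀ y, u (b y, y) = g (b y, y) := fun y => hug ⟨hφb y, min_le_right _ _⟩
  have hgc := hg.continuous
  have iW := hW.intervalIntegrable_slice hφc continuous_const hφ1 0 ε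
  have iWb := hW.intervalIntegrable_slice hφc hbc hφb 0 ε
  have iPb := hP.intervalIntegrable_slice hφc hbc hφb 0 ε
  have iF := hFb.intervalIntegrable_slice hφc continuous_const hφ1 0 ε
  have hshift : ∫ y in (0 : ℝ)..ε, ∫ x in φ y..1, F (x, y) ≤
      (∫ y in (0 : ℝ)..ε, ∫ x in φ y..1, areaDensity g (x, y)) -
      (∫ y in (0 : ℝ)..ε, ∫ x in φ y..b y, areaDensity g (x, y)) + s * ε := by
    have := intervalIntegral.integral_mono_on hε.le iF
      ((iW.sub iWb).add (intervalIntegrable_const (c := s))) fun y _ =>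
        integral_shift_le (fun a b => hW.intervalIntegrable_fst y a b) (hφ1 y) hs
    rw [intervalIntegral.integral_add (iW.sub iWb) intervalIntegrable_const,
      intervalIntegral.integral_sub iW iWb, intervalIntegral.integral_const, smul_eq_mul] at this
    linarith
  have hbdry : (∫ y in (0 : ℝ)..ε, u (φ y, y) * C y) - (∫ y in (0 : ℝ)..ε, u (b y, y) * C y) ≤
      ν * ∫ y in (0 : ℝ)..ε, ∫ x in φ y..b y, |pdx g (x, y)| := by
    simp only [e1, e2]
    have j1 : IntervalIntegrable (fun y => g (φ y, y) * C y) volume 0 ε :=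
      Continuous.intervalIntegrable (by fun_prop) _ _
    have j2 : IntervalIntegrable (fun y => g (b y, y) * C y) volume 0 ε :=
      Continuous.intervalIntegrable (by fun_prop) _ _
    rw [← intervalIntegral.integral_sub j1 j2, ← intervalIntegral.integral_const_mul]
    refine intervalIntegral.integral_mono_ae hε.le (j1.sub j2) (iPb.const_mul ν) ?_
    filter_upwards [hg.ae_integral_pdx] with y hy
    have h1 : |g (φ y, y) - g (b y, y)| ≤ ∫ x in φ y..b y, |pdx g (x, y)| := by
      rw [abs_sub_comm, ← hy]
      exact intervalIntegral.abs_integral_le_integral_abs (hφb y)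
    have h2 := (hν y)
    calc g (φ y, y) * C y - g (b y, y) * C y ≤ |g (φ y, y) - g (b y, y)| * |C y| := by
          rw [← abs_mul, sub_mul]; exact le_abs_self _
      _ ≤ (∫ x in φ y..b y, |pdx g (x, y)|) * ν :=
          mul_le_mul h1 h2 (abs_nonneg _) ((abs_nonneg _).trans h1)
      _ = _ := mul_comm _ _
  have hsplit : ∫ y in (0 : ℝ)..ε, ∫ x in φ y..b y,
      (areaDensity g (x, y) - ν * |pdx g (x, y)|) =
      (∫ y in (0 : ℝ)..ε, ∫ x in φ y..b y, areaDensity g (x, y)) -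
        ν * ∫ y in (0 : ℝ)..ε, ∫ x in φ y..b y, |pdx g (x, y)| := by
    rw [← intervalIntegral.integral_const_mul, ← intervalIntegral.integral_sub iWb
      (iPb.const_mul ν)]
    congr 1
    ext y
    rw [intervalIntegral.integral_sub (hW.intervalIntegrable_fst y _ _)
      ((hP.intervalIntegrable_fst y _ _).const_mul ν), intervalIntegral.integral_const_mul]
  rw [hsplit]
  linarith

section Average

variable {g : ℝ × ℝ → ℝ} {K : NNReal} {ε : ℝ}

theorem LipschitzWith.ae_hasDerivAt_average (hg : LipschitzWith K g) :
    ∀ᵐ x : ℝ, HasDerivAt (fun x => (1 / ε) * ∫ y in (0 : ℝ)..ε, g (x, y))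
      ((1 / ε) * ∫ y in (0 : ℝ)..ε, pdx g (x, y)) x := by
  have hgc := hg.continuous
  filter_upwards [hg.ae_ae_differentiableAt_snd] with x hx
  refine HasDerivAt.const_mul _ ?_
  refine (intervalIntegral.hasDerivAt_integral_of_dominated_loc_of_lip (bound := fun _ => (K : ℝ))
    Filter.univ_mem
    (Filter.Eventually.of_forall fun x' =>
      (by fun_prop : Continuous fun y => g (x', y)).aestronglyMeasurable)
    (Continuous.intervalIntegrable (by fun_prop) _ _)
    ((hg.bddMeas_pdx.1.comp (by fun_prop : Measurable fun y : ℝ => (x, y))).aestronglyMeasurable)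
    (Filter.Eventually.of_forall fun y _ => ?_) intervalIntegrable_const ?_).2
  · simpa using hg.fst_slice y
  · filter_upwards [hx] with y hy _ using hasDerivAt_fst_slice hy

/-- Jensen's inequality for the averaged area integrand. -/
theorem sqrt_one_add_sq_average_le (hg : LipschitzWith K g) (hε : 0 < ε) (x : ℝ) :
    Real.sqrt (1 + ((1 / ε) * ∫ y in (0 : ℝ)..ε, pdx g (x, y)) ^ 2) ≤
      (1 / ε) * ∫ y in (0 : ℝ)..ε, areaDensity g (x, y) := by
  set a := (1 / ε) * ∫ y in (0 : ℝ)..ε, pdx g (x, y) with ha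
  set r := Real.sqrt (1 + a ^ 2) with hr
  have hr2 : r ^ 2 = 1 + a ^ 2 := Real.sq_sqrt (by positivity)
  have hr0 : 0 < r := Real.sqrt_pos.2 (by positivity)
  have iP := hg.bddMeas_pdx.intervalIntegrable_snd x 0 ε
  have iW := hg.bddMeas_areaDensity.intervalIntegrable_snd x 0 ε
  have key : ∫ y in (0 : ℝ)..ε, (1 + a * pdx g (x, y)) ≤
      ∫ y in (0 : ℝ)..ε, r * areaDensity g (x, y) := by
    refine intervalIntegral.integral_mono_on hε.le
      (intervalIntegrable_const.add (iP.const_mul a)) (iW.const_mul r) fun y _ => ?_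
    have h1 := one_le_areaDensity g (x, y)
    have h2 := areaDensity_sq g (x, y)
    refine abs_le_of_sq_le_sq' ?_ (by positivity) |>.2
    rw [mul_pow, hr2, h2]
    nlinarith [sq_nonneg (a - pdx g (x, y)), sq_nonneg (pdy g (x, y)),
      sq_nonneg (a * pdy g (x, y))]
  rw [intervalIntegral.integral_add intervalIntegrable_const (iP.const_mul a),
    intervalIntegral.integral_const_mul, intervalIntegral.integral_const_mul,
    intervalIntegral.integral_const] at key
  have hp : ∫ y in (0 : ℝ)..ε, pdx g (x, y) = ε * a := by rw [ha]; field_simp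
  rw [hp] at key
  simp only [sub_zero, smul_eq_mul, mul_one] at key
  rw [one_div, ← div_eq_inv_mul, le_div_iff₀ hε]
  refine le_of_mul_le_mul_left ?_ hr0
  calc r * (r * ε) = ε * r ^ 2 := by ring
    _ = ε + a * (ε * a) := by rw [hr2]; ring
    _ ≤ _ := key

theorem integral_abs_sub_average_le {f N : ℝ → ℝ} {B : ℝ} (hε : 0 < ε)
    (hf : IntervalIntegrable f volume 0 ε) (hN : IntervalIntegrable N volume 0 ε)
    (hB : ∀ᵐ y, ∀ᵐ y', y ∈ Ioc 0 ε → y' ∈ Ioc 0 ε → |(f y + N y) - (f y' + N y')| ≤ B) :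
    ∫ y in (0 : ℝ)..ε, |f y - (1 / ε) * ∫ z in (0 : ℝ)..ε, f z| ≤
      ε * B + 2 * ∫ y in (0 : ℝ)..ε, |N y| := by
  set n := ∫ y in (0 : ℝ)..ε, |N y| with hn
  have hNn : |∫ y in (0 : ℝ)..ε, N y| ≤ n := intervalIntegral.abs_integral_le_integral_abs hε.le
  have key : ∀ᵐ y, y ∈ Ioc 0 ε →
      |f y - (1 / ε) * ∫ z in (0 : ℝ)..ε, f z| ≤ B + |N y| + (1 / ε) * n := by
    filter_upwards [hB] with y hy hyI
    have h1 : |∫ z in (0 : ℝ)..ε, ((f y + N y) - (f z + N z))| ≤ B * |ε - 0| := by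
      refine intervalIntegral.norm_integral_le_of_norm_le_const_ae (E := ℝ) ?_
      filter_upwards [hy] with z hz hzI
      rw [uIoc_of_le hε.le] at hzI
      exact hz hyI hzI
    rw [intervalIntegral.integral_sub intervalIntegrable_const (hf.add hN),
      intervalIntegral.integral_add hf hN, intervalIntegral.integral_const, sub_zero,
      abs_of_pos hε, smul_eq_mul] at h1
    have e : f y - (1 / ε) * ∫ z in (0 : ℝ)..ε, f z =
        (1 / ε) * ((ε * (f y + N y) - ((∫ z in (0 : ℝ)..ε, f z) + ∫ z in (0 : ℝ)..ε, N z))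
          + ∫ z in (0 : ℝ)..ε, N z) - N y := by
      field_simp
      ring
    rw [e]
    refine (abs_sub _ _).trans ?_
    rw [abs_mul, abs_of_pos (by positivity : 0 < 1 / ε)]
    have h2 := (abs_add_le _ _).trans (add_le_add h1 hNn)
    have h3 := mul_le_mul_of_nonneg_left h2 (by positivity : 0 ≤ 1 / ε)
    have h4 : 1 / ε * (B * ε + n) = B + 1 / ε * n := by field_simp
    linarith
  have := intervalIntegral.integral_mono_ae_restrict hε.le
    (hf.sub intervalIntegrable_const).abs
    ((intervalIntegrable_const.add hN.abs).add intervalIntegrable_const)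
    (f := fun y => |f y - (1 / ε) * ∫ z in (0 : ℝ)..ε, f z|)
    (g := fun y => B + |N y| + (1 / ε) * n)
    (by
      rw [← restrict_Ioc_eq_restrict_Icc]
      exact (ae_restrict_iff' measurableSet_Ioc).2 key)
  refine this.trans (le_of_eq ?_)
  rw [intervalIntegral.integral_add (intervalIntegrable_const.add hN.abs) intervalIntegrable_const,
    intervalIntegral.integral_add intervalIntegrable_const hN.abs,
    intervalIntegral.integral_const, intervalIntegral.integral_const, ← hn]
  simp only [smul_eq_mul, sub_zero]
  field_simp
  ring

/-- Recovering boundary values from a weighted average and a weighted normal derivative. -/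
theorem LipschitzWith.ae_integral_sin_sub_cos (hg : LipschitzWith K g) {k : ℝ}
    (hk : k * ε = Real.pi / 2) :
    ∀ᵐ y : ℝ, g (0, y) + ∫ x in (0 : ℝ)..ε, Real.cos (k * x) * pdx g (x, y) =
      ∫ x in (0 : ℝ)..ε, k * Real.sin (k * x) * g (x, y) := by
  filter_upwards [hg.ae_ae_differentiableAt_fst] with y hy
  have hgc := hg.continuous
  have hcos : AbsolutelyContinuousOnInterval (fun x => Real.cos (k * x)) 0 ε :=
    ContDiffOn.absolutelyContinuousOnInterval (by fun_prop)
  have h := (hcos.fun_mul ((hg.fst_slice y).lipschitzOnWith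
    (s := uIcc 0 ε)).absolutelyContinuousOnInterval).integral_deriv_eq_sub
  have iS : IntervalIntegrable (fun x => k * Real.sin (k * x) * g (x, y)) volume 0 ε :=
    Continuous.intervalIntegrable (by fun_prop) _ _
  have iC : IntervalIntegrable (fun x => Real.cos (k * x) * pdx g (x, y)) volume 0 ε :=
    (hg.bddMeas_pdx.intervalIntegrable_fst y 0 ε).continuousOn_mul (by fun_prop)
  have hd : ∫ x in (0 : ℝ)..ε, deriv (fun x => Real.cos (k * x) * g (x, y)) x =
      ∫ x in (0 : ℝ)..ε,
        (Real.cos (k * x) * pdx g (x, y) - k * Real.sin (k * x) * g (x, y)) := by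
    refine intervalIntegral.integral_congr_ae ?_
    filter_upwards [hy] with x hx _
    have h1 : HasDerivAt (fun x => Real.cos (k * x)) (-Real.sin (k * x) * (k * 1)) x :=
      ((hasDerivAt_id x).const_mul k).cos
    rw [(h1.fun_mul (hasDerivAt_fst_slice hx)).deriv]
    ring
  rw [hd, intervalIntegral.integral_sub iC iS, hk] at h
  simp only [Real.cos_pi_div_two, mul_zero, Real.cos_zero, zero_mul, one_mul] at h
  linarith

theorem abs_sub_le_integral_abs_pdy {x : ℝ} (hP : BddMeas (pdy g))
    (hx : ∀ a b, ∫ y in a..b, pdy g (x, y) = g (x, b) - g (x, a)) {y y' : ℝ}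
    (hy : y ∈ Ioc 0 ε) (hy' : y' ∈ Ioc 0 ε) :
    |g (x, y) - g (x, y')| ≤ ∫ z in (0 : ℝ)..ε, |pdy g (x, z)| := by
  rw [← hx]
  refine (intervalIntegral.norm_integral_le_integral_norm_uIoc (E := ℝ)).trans ?_
  rw [intervalIntegral.integral_of_le (hy.1.le.trans hy.2)]
  refine setIntegral_mono_set ((hP.abs.intervalIntegrable_snd x 0 ε).1)
    (Filter.Eventually.of_forall fun z => abs_nonneg _) (LE.le.eventuallyLE ?_)
  exact Ioc_subset_Ioc (le_min hy'.1.le hy.1.le) (max_le hy'.2 hy.2)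

/-- A trace inequality: the mean oscillation on `x = 0` is controlled by the area integrand over
the square of side `ε`. -/
theorem trace_estimate (hg : LipschitzWith K g) (hε : 0 < ε) :
    ∫ y in (0 : ℝ)..ε, |g (0, y) - (1 / ε) * ∫ z in (0 : ℝ)..ε, g (0, z)| ≤
      2 * ∫ y in (0 : ℝ)..ε, ∫ x in (0 : ℝ)..ε, areaDensity g (x, y) := by
  obtain ⟨k, hk⟩ : ∃ k : ℝ, k * ε = Real.pi / 2 := ⟨Real.pi / 2 / ε, by field_simp⟩
  have hk0 : 0 < k := pos_of_mul_pos_left (hk ▸ by positivity) hε.le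
  have hgc := hg.continuous
  have hcosB : BddMeas fun p : ℝ × ℝ => Real.cos (k * p.1) :=
    ⟨by fun_prop, 1, fun p => Real.abs_cos_le_one _⟩
  have hsinB : BddMeas fun p : ℝ × ℝ => Real.sin (k * p.1) :=
    ⟨by fun_prop, 1, fun p => Real.abs_sin_le_one _⟩
  have hN := hcosB.mul hg.bddMeas_pdx
  have hQ := (hsinB.mul hg.bddMeas_pdy).abs
  have hW := hg.bddMeas_areaDensity
  set N : ℝ → ℝ := fun y => ∫ x in (0 : ℝ)..ε, Real.cos (k * x) * pdx g (x, y) with hNdef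
  set B : ℝ := ∫ x in (0 : ℝ)..ε, ∫ z in (0 : ℝ)..ε, |Real.sin (k * x) * pdy g (x, z)| with hBdef
  have slice : ∀ {F : ℝ × ℝ → ℝ}, BddMeas F →
      IntervalIntegrable (fun y => ∫ x in (0 : ℝ)..ε, F (x, y)) volume 0 ε := fun hF =>
    hF.intervalIntegrable_slice continuous_const continuous_const (fun _ => hε.le) 0 ε
  have hosc : ∀ᵐ y, ∀ᵐ y', y ∈ Ioc 0 ε → y' ∈ Ioc 0 ε →
      |(g (0, y) + N y) - (g (0, y') + N y')| ≤ k * B := by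
    filter_upwards [hg.ae_integral_sin_sub_cos hk] with y hy
    filter_upwards [hg.ae_integral_sin_sub_cos hk] with y' hy' hyI hyI'
    have iS : ∀ y, IntervalIntegrable (fun x => k * Real.sin (k * x) * g (x, y)) volume 0 ε :=
      fun y => Continuous.intervalIntegrable (by fun_prop) _ _
    simp only [hNdef]
    rw [hy, hy', ← intervalIntegral.integral_sub (iS y) (iS y'), hBdef,
      ← intervalIntegral.integral_const_mul]
    refine (intervalIntegral.abs_integral_le_integral_abs hε.le).trans ?_
    refine intervalIntegral.integral_mono_ae hε.le ((iS y).sub (iS y')).abs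
      (IntervalIntegrable.const_mul (slice hQ.swap) k) ?_
    filter_upwards [hg.ae_integral_pdy] with x hx
    simp only [abs_mul, intervalIntegral.integral_const_mul]
    rw [← mul_sub, abs_mul, abs_mul, abs_of_pos hk0, mul_assoc]
    gcongr
    exact abs_sub_le_integral_abs_pdy hg.bddMeas_pdy hx hyI hyI'
  have h1 := integral_abs_sub_average_le hε
    (Continuous.intervalIntegrable (by fun_prop : Continuous fun y => g (0, y)) 0 ε)
    (slice hN) hosc
  refine h1.trans ?_
  have hB0 : 0 ≤ B := intervalIntegral.integral_nonneg hε.le fun x _ =>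
    intervalIntegral.integral_nonneg hε.le fun z _ => abs_nonneg _
  have hBswap : B = ∫ y in (0 : ℝ)..ε, ∫ x in (0 : ℝ)..ε, |Real.sin (k * x) * pdy g (x, y)| :=
    hQ.integral_swap hε.le hε.le
  have hkB : ε * (k * B) ≤ 2 * B := by
    rw [← mul_assoc, mul_comm ε k, hk]
    exact mul_le_mul_of_nonneg_right (by linarith [Real.pi_le_four]) hB0
  have hNle : ∫ y in (0 : ℝ)..ε, |N y| ≤
      ∫ y in (0 : ℝ)..ε, ∫ x in (0 : ℝ)..ε, |Real.cos (k * x) * pdx g (x, y)| :=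
    intervalIntegral.integral_mono_on hε.le (slice hN).abs (slice hN.abs) fun y _ =>
      intervalIntegral.abs_integral_le_integral_abs hε.le
  have hsum : B + ∫ y in (0 : ℝ)..ε, ∫ x in (0 : ℝ)..ε, |Real.cos (k * x) * pdx g (x, y)| ≤
      ∫ y in (0 : ℝ)..ε, ∫ x in (0 : ℝ)..ε, areaDensity g (x, y) := by
    rw [hBswap, ← intervalIntegral.integral_add (slice hQ) (slice hN.abs)]
    refine intervalIntegral.integral_mono_on hε.le ((slice hQ).add (slice hN.abs)) (slice hW)
      fun y _ => ?_
    rw [← intervalIntegral.integral_add (hQ.intervalIntegrable_fst y 0 ε)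
      (hN.abs.intervalIntegrable_fst y 0 ε)]
    refine intervalIntegral.integral_mono_on hε.le ((hQ.intervalIntegrable_fst y 0 ε).add
      (hN.abs.intervalIntegrable_fst y 0 ε)) (hW.intervalIntegrable_fst y 0 ε) fun x _ => ?_
    refine abs_le_of_sq_le_sq' ?_ (zero_le_one.trans (one_le_areaDensity _ _)) |>.2
    rw [areaDensity_sq, abs_mul, abs_mul, ← sq_abs (pdx g _), ← sq_abs (pdy g _)]
    have hcs : |Real.sin (k * x)| ^ 2 + |Real.cos (k * x)| ^ 2 = 1 := by
      simp [Real.sin_sq_add_cos_sq]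
    generalize |Real.sin (k * x)| = a at *
    generalize |Real.cos (k * x)| = b at *
    have hb : b ^ 2 = 1 - a ^ 2 := by linarith
    nlinarith [sq_nonneg (b * |pdy g (x, y)| - a * |pdx g (x, y)|)]
  linarith

end Average

theorem ybar_eq {ε : ℝ} (hε : 0 < ε) {φ : ℝ → ℝ} (hφ0 : ∀ y, φ y ≤ 0) {u g : ℝ × ℝ → ℝ}
    (hug : EqOn u g (DomBar φ)) {x : ℝ} (hx : x ∈ Icc (0 : ℝ) 1) :
    ybar ε u x = (1 / ε) * ∫ y in (0 : ℝ)..ε, g (x, y) := by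
  rw [ybar, intervalIntegral.integral_of_le hε.le, integral_Ioc_eq_integral_Ioo]
  congr 2
  ext y
  exact hug ⟨(hφ0 y).trans hx.1, hx.2⟩

theorem integral_sqrt_deriv_ybar_le {ε : ℝ} (hε : 0 < ε) {φ : ℝ → ℝ} (hφ0 : ∀ y, φ y ≤ 0)
    {u g : ℝ × ℝ → ℝ} {K : NNReal} (hg : LipschitzWith K g) (hug : EqOn u g (DomBar φ)) :
    ∫ x in Ioo (0 : ℝ) 1, Real.sqrt (1 + (deriv (ybar ε u) x) ^ 2) ≤
      (1 / ε) * ∫ y in (0 : ℝ)..ε, ∫ x in (0 : ℝ)..1, areaDensity g (x, y) := by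
  have hW := hg.bddMeas_areaDensity
  rw [← hW.integral_swap zero_le_one hε.le, ← intervalIntegral.integral_const_mul,
    intervalIntegral.integral_of_le zero_le_one, integral_Ioc_eq_integral_Ioo]
  have hi := (hW.swap.intervalIntegrable_slice (a := fun _ => 0) (b := fun _ => ε)
    continuous_const continuous_const (fun _ => hε.le) 0 1).const_mul (1 / ε)
  refine integral_mono_of_nonneg (Filter.Eventually.of_forall fun x => Real.sqrt_nonneg _)
    (hi.1.mono_set Ioo_subset_Ioc_self) ((ae_restrict_iff' measurableSet_Ioo).2 ?_)
  filter_upwards [hg.ae_hasDerivAt_average (ε := ε)] with x hx hxI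
  have he : ybar ε u =ᶠ[nhds x] fun x => (1 / ε) * ∫ y in (0 : ℝ)..ε, g (x, y) := by
    filter_upwards [isOpen_Ioo.mem_nhds hxI] with t ht
    exact ybar_eq hε hφ0 hug (Ioo_subset_Icc_self ht)
  rw [he.deriv_eq, hx.deriv]
  exact sqrt_one_add_sq_average_le hg hε x

/-- Lemma 5.4: if `u ∈ V` minimizes `𝓔` over `V`, then the one-dimensional energy of
its `y`-average satisfies `E(ū) ≤ 𝓔(u) + (2ν/(1−ν))(1+H)ε`. -/
theorem energy_of_average_estimate
    (ε ν H : ℝ) (φ c : ℝ → ℝ) (hctx : Ctx ε ν H φ c)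
    (u : ℝ × ℝ → ℝ) (hu : memV ε φ u)
    (hmin : ∀ v : ℝ × ℝ → ℝ, memV ε φ v → En ε φ c u ≤ En ε φ c v) :
    En1 (cosA ε φ c) (ybar ε u) ≤ En ε φ c u + (2 * ν / (1 - ν)) * (1 + H) * ε := by
  obtain ⟨⟨hε, hε1⟩, ⟨hν0, hν1⟩, hH, hφ, -, hφl, hφ0, hc, -, hν'⟩ := hctx
  obtain ⟨⟨K, hK⟩, -, -⟩ := id hu
  obtain ⟨g, hg, hug⟩ := hK.extend_real
  have hφ1 : ∀ y, φ y ≤ 1 := fun y => (hφ0 y).trans zero_le_one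
  have hφc := hφ.continuous
  have hgc := hg.continuous
  have hW := hg.bddMeas_areaDensity
  have hP := hg.bddMeas_pdx.abs
  set C : ℝ → ℝ := fun y => c y * Real.sqrt (1 + (deriv φ y) ^ 2) with hC
  have hCc : Continuous C := by
    have := hφ.continuous_deriv le_rfl
    fun_prop
  have hν : ∀ y, |C y| ≤ ν := fun y => by
    rw [hC, abs_mul, abs_of_nonneg (Real.sqrt_nonneg _)]
    exact hν' y
  set s := (1 + H) * ε with hs
  have hs0 : 0 ≤ s := by positivity
  have hstrip := strip_estimate hε hs0 hφ hφ1 hc hν hu hmin hg hug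
  have htrace := trace_estimate hg hε
  have hjensen := integral_sqrt_deriv_ybar_le hε hφ0 hg hug
  have hbc : Continuous fun y => min (φ y + s) 1 := by fun_prop
  have hφb : ∀ y, φ y ≤ min (φ y + s) 1 := fun y => le_min (by linarith) (hφ1 y)
  have hεb : ∀ y, ε ≤ min (φ y + s) 1 := fun y =>
    le_min (by linarith [hφl y, (by rw [hs]; ring : s = ε + ε * H)]) hε1
  have iSq := hW.intervalIntegrable_slice (a := fun _ => 0) (b := fun _ => ε)
    continuous_const continuous_const (fun _ => hε.le) 0 ε
  have iW0 := hW.intervalIntegrable_slice hφc continuous_const hφ0 0 ε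
  have iW1 := hW.intervalIntegrable_slice (a := fun _ => 0) (b := fun _ => 1)
    continuous_const continuous_const (fun _ => zero_le_one) 0 ε
  have iP0 := hP.intervalIntegrable_slice hφc continuous_const hφ0 0 ε
  set m := (1 / ε) * ∫ z in (0 : ℝ)..ε, g (0, z) with hm
  have hsquare : (1 - ν) * ∫ y in (0 : ℝ)..ε, ∫ x in (0 : ℝ)..ε, areaDensity g (x, y) ≤ s * ε := by
    have hD : BddMeas fun p => areaDensity g p - ν * |pdx g p| := by
      obtain ⟨hWm, M, hM⟩ := hW
      obtain ⟨hPm, M', hM'⟩ := hP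
      refine ⟨by fun_prop, M + ν * M', fun p => (abs_sub _ _).trans (add_le_add (hM p) ?_)⟩
      rw [abs_mul, abs_of_nonneg hν0]
      exact mul_le_mul_of_nonneg_left (hM' p) hν0
    have hD0 : ∀ p, (1 - ν) * areaDensity g p ≤ areaDensity g p - ν * |pdx g p| := fun p => by
      nlinarith [abs_pdx_le_areaDensity g p]
    refine le_trans ?_ hstrip
    rw [← intervalIntegral.integral_const_mul]
    refine intervalIntegral.integral_mono_on hε.le (iSq.const_mul _)
      (hD.intervalIntegrable_slice hφc hbc hφb 0 ε) fun y _ => ?_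
    rw [← intervalIntegral.integral_const_mul]
    refine (intervalIntegral.integral_mono_on hε.le
      ((hW.intervalIntegrable_fst y 0 ε).const_mul _)
      (hD.intervalIntegrable_fst y 0 ε) fun x _ => hD0 (x, y)).trans ?_
    refine intervalIntegral.integral_mono_interval (hφ0 y) hε.le (hεb y)
      (Filter.Eventually.of_forall fun x => ?_) (hD.intervalIntegrable_fst y _ _)
    exact (mul_nonneg (by linarith) (zero_le_one.trans (one_le_areaDensity g (x, y)))).trans
      (hD0 (x, y))
  have hleft : ν * ∫ y in (0 : ℝ)..ε, ∫ x in φ y..0, |pdx g (x, y)| ≤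
      ∫ y in (0 : ℝ)..ε, ∫ x in φ y..0, areaDensity g (x, y) := by
    have h0 : ∫ y in (0 : ℝ)..ε, ∫ x in φ y..0, |pdx g (x, y)| ≤
        ∫ y in (0 : ℝ)..ε, ∫ x in φ y..0, areaDensity g (x, y) :=
      intervalIntegral.integral_mono_on hε.le iP0 iW0 fun y _ =>
        intervalIntegral.integral_mono_on (hφ0 y) (hP.intervalIntegrable_fst y _ _)
          (hW.intervalIntegrable_fst y _ _) fun x _ => abs_pdx_le_areaDensity g (x, y)
    have h1 : 0 ≤ ∫ y in (0 : ℝ)..ε, ∫ x in φ y..0, |pdx g (x, y)| :=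
      intervalIntegral.integral_nonneg hε.le fun y _ =>
        intervalIntegral.integral_nonneg (hφ0 y) fun x _ => abs_nonneg _
    nlinarith
  have hbdry : (∫ y in (0 : ℝ)..ε, g (φ y, y) * C y) - m * ∫ y in (0 : ℝ)..ε, C y ≤
      ν * (∫ y in (0 : ℝ)..ε, ∫ x in φ y..0, |pdx g (x, y)|) +
        ν * ∫ y in (0 : ℝ)..ε, |g (0, y) - m| := by
    have j1 : IntervalIntegrable (fun y => g (φ y, y) * C y) volume 0 ε :=
      Continuous.intervalIntegrable (by fun_prop) _ _
    have j2 : IntervalIntegrable (fun y => m * C y) volume 0 ε :=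
      Continuous.intervalIntegrable (by fun_prop) _ _
    have j3 : IntervalIntegrable (fun y => |g (0, y) - m|) volume 0 ε :=
      Continuous.intervalIntegrable (by fun_prop) _ _
    rw [← mul_add, ← intervalIntegral.integral_const_mul, ← intervalIntegral.integral_sub j1 j2,
      ← intervalIntegral.integral_add iP0 j3, ← intervalIntegral.integral_const_mul]
    refine intervalIntegral.integral_mono_ae hε.le (j1.sub j2) ((iP0.add j3).const_mul ν) ?_
    filter_upwards [hg.ae_integral_pdx] with y hy
    have h1 : |g (φ y, y) - g (0, y)| ≤ ∫ x in φ y..0, |pdx g (x, y)| := by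
      rw [abs_sub_comm, ← hy]
      exact intervalIntegral.abs_integral_le_integral_abs (hφ0 y)
    have h2 := (abs_sub_le (g (φ y, y)) (g (0, y)) m).trans (add_le_add_left h1 _)
    calc g (φ y, y) * C y - m * C y ≤ |g (φ y, y) - m| * |C y| := by
          rw [← abs_mul, sub_mul]; exact le_abs_self _
      _ ≤ ((∫ x in φ y..0, |pdx g (x, y)|) + |g (0, y) - m|) * ν :=
          mul_le_mul h2 (hν y) (abs_nonneg _) ((abs_nonneg _).trans h2)
      _ = _ := mul_comm _ _
  have hsplit : ∫ y in (0 : ℝ)..ε, ∫ x in φ y..1, areaDensity g (x, y) =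
      (∫ y in (0 : ℝ)..ε, ∫ x in φ y..0, areaDensity g (x, y)) +
        ∫ y in (0 : ℝ)..ε, ∫ x in (0 : ℝ)..1, areaDensity g (x, y) := by
    rw [← intervalIntegral.integral_add iW0 iW1]
    congr 1
    ext y
    exact (intervalIntegral.integral_add_adjacent_intervals (hW.intervalIntegrable_fst y _ _)
      (hW.intervalIntegrable_fst y _ _)).symm
  have hcos : cosA ε φ c = (1 / ε) * ∫ y in (0 : ℝ)..ε, C y := by
    rw [cosA, intervalIntegral.integral_of_le hε.le, integral_Ioc_eq_integral_Ioo]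
  have hu1 : ∀ y, u (φ y, y) = g (φ y, y) := fun y => hug ⟨le_rfl, hφ1 y⟩
  rw [En1, ybar_eq hε hφ0 hug (by simp), ← hm, hcos, En_eq_of_ae hε hφc hφ1 hW
    (Filter.Eventually.of_forall fun p => areaDensity_dom hφc hug), hsplit]
  simp only [hu1]
  set I0 := ∫ y in (0 : ℝ)..ε, ∫ x in φ y..0, areaDensity g (x, y)
  set I1 := ∫ y in (0 : ℝ)..ε, ∫ x in (0 : ℝ)..1, areaDensity g (x, y)
  set S := ∫ y in (0 : ℝ)..ε, ∫ x in (0 : ℝ)..ε, areaDensity g (x, y)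
  set J := ∫ y in (0 : ℝ)..ε, g (φ y, y) * C y
  set β := ∫ y in (0 : ℝ)..ε, C y
  have hS : S ≤ s * ε / (1 - ν) := by
    rw [le_div_iff₀ (by linarith), mul_comm]
    exact hsquare
  have hfin : J - m * β - I0 ≤ ν * (2 * (s * ε / (1 - ν))) := by
    have h1 := mul_le_mul_of_nonneg_left htrace hν0
    have h2 := mul_le_mul_of_nonneg_left hS hν0
    linarith
  have h3 := mul_le_mul_of_nonneg_left hfin (by positivity : 0 ≤ 1 / ε)
  have h4 : 1 / ε * (ν * (2 * (s * ε / (1 - ν)))) = 2 * ν / (1 - ν) * (1 + H) * ε := by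
    have : (1 - ν) ≠ 0 := by linarith
    rw [hs]
    field_simp
  rw [h4] at h3
  linarith
end
end

section
/- (Lemma 5.5, minimization part) Let β ∈ (−1,1), k = β/√(1−β²), and u₀(x) = k(1−x). Then u₀ is the unique minimizer of E_β over the class of Lipschitz functions w : [0,1] → ℝ with w(1) = 0: E_β(u₀) ≤ E_β(w) for every such w, with equality only if w = u₀; moreover E_β(u₀) = 1/√(1+k²) = √(1−β²) ≤ 1. -/
open MeasureTheory Set

noncomputable section

/-- The line supporting the graph of `p ↦ √(1 + p²)` with slope `-β` lies below it. -/
theorem sub_mul_le_sqrt_one_add_sq {β s : ℝ} (hs : s ^ 2 + β ^ 2 = 1) (p : ℝ) :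
    s - β * p ≤ Real.sqrt (1 + p ^ 2) := by
  apply Real.le_sqrt_of_sq_le
  nlinarith [sq_nonneg (β + s * p)]

/-- The supporting line of slope `-β` touches the graph only at `p = -β / s`. -/
theorem eq_neg_div_of_sqrt_one_add_sq_eq {β s p : ℝ} (hs0 : 0 < s) (hs : s ^ 2 + β ^ 2 = 1)
    (h : Real.sqrt (1 + p ^ 2) = s - β * p) : p = -(β / s) := by
  have h1 : 1 + p ^ 2 = (s - β * p) ^ 2 := by
    rw [← h, Real.sq_sqrt (by positivity)]
  have h2 : (β + s * p) ^ 2 = 0 := by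
    linear_combination h1 + (1 + p ^ 2) * hs
  have h3 : β + s * p = 0 := pow_eq_zero_iff two_ne_zero |>.mp h2
  field_simp
  linarith

/-- If the derivative of a real function is integrable on a finite measure, so is the arc length
density. -/
theorem integrable_sqrt_one_add_deriv_sq {μ : Measure ℝ} [IsFiniteMeasure μ] {w : ℝ → ℝ}
    (h : Integrable (deriv w) μ) : Integrable (fun x => Real.sqrt (1 + (deriv w x) ^ 2)) μ := by
  refine ((integrable_const (1 : ℝ)).add h.abs).mono' ?_ (Filter.Eventually.of_forall fun x => ?_)
  · exact (((measurable_deriv w).pow_const 2).const_add 1).sqrt.aestronglyMeasurable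
  · rw [Real.norm_of_nonneg (Real.sqrt_nonneg _)]
    refine Real.sqrt_le_iff.mpr ⟨by simp only [Pi.add_apply]; positivity, ?_⟩
    simp only [Pi.add_apply]
    nlinarith [abs_nonneg (deriv w x), sq_abs (deriv w x)]

/-- Energy of an absolutely continuous function vanishing at `1`, in terms of the integral of its
(nonnegative) excess over the supporting line. -/
theorem En1_eq_add_integral {β : ℝ} (s : ℝ) {w : ℝ → ℝ}
    (hw : AbsolutelyContinuousOnInterval w 0 1) (hw1 : w 1 = 0) :
    En1 β w = s + ∫ x in Ioo (0 : ℝ) 1,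
      (Real.sqrt (1 + (deriv w x) ^ 2) - (s - β * deriv w x)) := by
  have hd : IntegrableOn (deriv w) (Ioo 0 1) :=
    (intervalIntegrable_iff_integrableOn_Ioo_of_le zero_le_one).mp hw.intervalIntegrable_deriv
  have hFTC : ∫ x in Ioo (0 : ℝ) 1, deriv w x = - w 0 := by
    rw [← integral_Ioc_eq_integral_Ioo, ← intervalIntegral.integral_of_le zero_le_one,
      hw.integral_deriv_eq_sub, hw1, zero_sub]
  have hline : IntegrableOn (fun x => s - β * deriv w x) (Ioo 0 1) :=
    (integrable_const s).sub (hd.const_mul β)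
  rw [integral_sub (integrable_sqrt_one_add_deriv_sq hd) hline,
    integral_sub (integrable_const s) (hd.const_mul β), integral_const_mul, hFTC, En1]
  simp
  ring

/-- An absolutely continuous function vanishing at `1` with a.e. constant derivative is affine. -/
theorem eq_mul_one_sub_of_deriv_ae_eq {k : ℝ} {w : ℝ → ℝ}
    (hw : AbsolutelyContinuousOnInterval w 0 1) (hw1 : w 1 = 0)
    (h : ∀ᵐ x ∂volume.restrict (Ioo (0 : ℝ) 1), deriv w x = -k) {x : ℝ}
    (hx : x ∈ Icc (0 : ℝ) 1) : w x = k * (1 - x) := by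
  have hsub : uIcc x 1 ⊆ uIcc 0 1 := by
    rw [uIcc_of_le hx.2, uIcc_of_le zero_le_one]
    exact Icc_subset_Icc_left hx.1
  have hFTC := (hw.mono hsub).integral_deriv_eq_sub
  have hconst : ∫ t in Ioo x 1, deriv w t = ∫ t in Ioo x 1, -k :=
    integral_congr_ae (ae_restrict_of_ae_restrict_of_subset (Ioo_subset_Ioo_left hx.1) h)
  rw [intervalIntegral.integral_of_le hx.2, integral_Ioc_eq_integral_Ioo, hconst,
    ← integral_Ioc_eq_integral_Ioo, ← intervalIntegral.integral_of_le hx.2,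
    intervalIntegral.integral_const, hw1, smul_eq_mul] at hFTC
  linarith

/-- Lemma 5.5 (minimization part): for `β ∈ (−1,1)`, `k = β/√(1−β²)`, the function
`u₀(x) = k(1−x)` is the unique minimizer of `E_β` over Lipschitz functions on `[0,1]`
vanishing at `1`, and `E_β(u₀) = 1/√(1+k²) = √(1−β²) ≤ 1`. -/
theorem one_dimensional_energy_unique_minimizer
    (β : ℝ) (hβ : β ∈ Ioo (-1 : ℝ) 1)
    (k : ℝ) (hk : k = β / Real.sqrt (1 - β ^ 2))
    (u₀ : ℝ → ℝ) (hu₀ : ∀ x, u₀ x = k * (1 - x)) :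
    (∀ w : ℝ → ℝ, (∃ K : NNReal, LipschitzOnWith K w (Icc (0 : ℝ) 1)) → w 1 = 0 →
      En1 β u₀ ≤ En1 β w ∧ (En1 β w = En1 β u₀ → ∀ x ∈ Icc (0 : ℝ) 1, w x = u₀ x)) ∧
    En1 β u₀ = 1 / Real.sqrt (1 + k ^ 2) ∧
    En1 β u₀ = Real.sqrt (1 - β ^ 2) ∧
    En1 β u₀ ≤ 1 := by
  have hlt : 0 < 1 - β ^ 2 := by nlinarith [hβ.1, hβ.2]
  set s := Real.sqrt (1 - β ^ 2) with hs_def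
  have hs0 : 0 < s := Real.sqrt_pos.mpr hlt
  have hs : s ^ 2 + β ^ 2 = 1 := by rw [hs_def, Real.sq_sqrt hlt.le]; ring
  have hk2 : Real.sqrt (1 + k ^ 2) = 1 / s := by
    rw [Real.sqrt_eq_iff_mul_self_eq (by positivity) (by positivity), hk]
    field_simp
    linarith
  have hderiv : deriv u₀ = fun _ => -k := by
    funext x
    rw [show u₀ = fun x => k * (1 - x) from funext hu₀]
    simp
  have hE : En1 β u₀ = s := by
    simp only [En1, hderiv, neg_sq, hk2, hu₀, setIntegral_const]
    simp [hk]
    field_simp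
    linarith
  refine ⟨fun w ⟨K, hK⟩ hw1 => ?_, ?_, hE, ?_⟩
  · have hw : AbsolutelyContinuousOnInterval w 0 1 :=
      LipschitzOnWith.absolutelyContinuousOnInterval (by rwa [uIcc_of_le zero_le_one])
    have hd : IntegrableOn (deriv w) (Ioo 0 1) :=
      (intervalIntegrable_iff_integrableOn_Ioo_of_le zero_le_one).mp hw.intervalIntegrable_deriv
    have hnonneg : ∀ x, 0 ≤ Real.sqrt (1 + (deriv w x) ^ 2) - (s - β * deriv w x) :=
      fun x => sub_nonneg.mpr (sub_mul_le_sqrt_one_add_sq hs _)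
    rw [hE, En1_eq_add_integral s hw hw1]
    refine ⟨le_add_of_nonneg_right (integral_nonneg hnonneg), fun h x hx => ?_⟩
    rw [add_eq_left, integral_eq_zero_iff_of_nonneg hnonneg
      ((integrable_sqrt_one_add_deriv_sq hd).sub
        ((integrable_const s).sub (hd.const_mul β)))] at h
    rw [hu₀]
    refine eq_mul_one_sub_of_deriv_ae_eq hw hw1 ?_ hx
    filter_upwards [h] with t ht
    rw [hk]
    exact eq_neg_div_of_sqrt_one_add_sq_eq hs0 hs (sub_eq_zero.mp ht)
  · rw [hE, hk2, one_div_one_div]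
  · rw [hE]
    nlinarith [sq_nonneg β]
end
end
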